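/- Let n ∈ ℕ, T > 0, x ∈ ℝ^n, and for t > 0 let P_t denote the Euclidean heat semigroup, P_t h(y) = ∫_{ℝ^n} h(y + √t·z) dγ_n(z). Let f: ℝ^n → ℝ be a smooth positive function (with suitable integrability and regularity so that all appearing quantities are finite) with ∫_{ℝ^n} f d(P_T δ_x) = 1, i.e., P_T f(x) = 1, where P_T δ_x is the Gaussian measure with density y ↦ (2πT)^{-n/2} e^{-|y−x|²/(2T)}. Let μ be the probability measure with dμ/d(P_T δ_x) = f. Then H(μ‖P_T δ_x) ≥ (T/2)·ΔP_T f(x) − (1/2)·P_T f(x)·log det( Id_n + T · ∇² log P_T f(x) ), where H(μ‖P_T δ_x) = P_T(f log f)(x) − P_T f(x) · log P_T f(x). -/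

import Mathlib

open MeasureTheory

/-- The `k`-th partial derivative of a function on `ℝⁿ`. -/
noncomputable def pderiv' {n : ℕ} (f : (Fin n → ℝ) → ℝ) (k : Fin n) (x : Fin n → ℝ) : ℝ :=
  fderiv ℝ f x (Pi.single k 1)

/-- The standard Gaussian measure `γₙ` on `ℝⁿ`. -/
noncomputable def stdGauss (n : ℕ) : Measure (Fin n → ℝ) :=
  volume.withDensity fun x =>
    ENNReal.ofReal ((2 * Real.pi) ^ (-(n : ℝ) / 2) * Real.exp (-(∑ i, x i ^ 2) / 2))

/-- The Euclidean heat semigroup `P_t h(y) = ∫ h(y + √t z) dγₙ(z)`. -/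
noncomputable def heatSG {n : ℕ} (t : ℝ) (h : (Fin n → ℝ) → ℝ) (y : Fin n → ℝ) : ℝ :=
  ∫ z, h (y + Real.sqrt t • z) ∂(stdGauss n)

/-- The Hessian matrix `∇²g(x)` of a function `g : ℝⁿ → ℝ`. -/
noncomputable def hessian {n : ℕ} (g : (Fin n → ℝ) → ℝ) (x : Fin n → ℝ) :
    Matrix (Fin n) (Fin n) ℝ :=
  Matrix.of fun i j => pderiv' (fun y => pderiv' g j y) i x


open ProbabilityTheory Matrix

/-- The density of `stdGauss n` with respect to Lebesgue measure. -/
noncomputable def gaussDensity {n : ℕ} (z : Fin n → ℝ) : ℝ :=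
  (2 * Real.pi) ^ (-(n : ℝ) / 2) * Real.exp (-(∑ i, z i ^ 2) / 2)

lemma gaussDensity_pos {n : ℕ} (z : Fin n → ℝ) : 0 < gaussDensity z := by
  unfold gaussDensity; positivity

lemma continuous_gaussDensity {n : ℕ} : Continuous (gaussDensity (n := n)) := by
  unfold gaussDensity; fun_prop

lemma stdGauss_eq_withDensity {n : ℕ} :
    stdGauss n = volume.withDensity fun z => ENNReal.ofReal (gaussDensity z) := rfl

lemma integrable_stdGauss_iff {n : ℕ} {k : (Fin n → ℝ) → ℝ} :
    Integrable k (stdGauss n) ↔ Integrable (fun z => gaussDensity z * k z) := by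
  have h := integrable_withDensity_iff_integrable_smul' (μ := (volume : Measure (Fin n → ℝ)))
    (f := fun z => ENNReal.ofReal (gaussDensity z)) (g := k)
    (continuous_gaussDensity.measurable.ennreal_ofReal) (by simp)
  simpa [ENNReal.toReal_ofReal (gaussDensity_pos _).le, stdGauss_eq_withDensity] using h

lemma integral_stdGauss {n : ℕ} (k : (Fin n → ℝ) → ℝ) :
    ∫ z, k z ∂(stdGauss n) = ∫ z, gaussDensity z * k z := by
  have h := integral_withDensity_eq_integral_toReal_smul (μ := (volume : Measure (Fin n → ℝ)))
    (f := fun z => ENNReal.ofReal (gaussDensity z))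
    (continuous_gaussDensity.measurable.ennreal_ofReal) (by simp) k
  simpa [ENNReal.toReal_ofReal (gaussDensity_pos _).le, stdGauss_eq_withDensity] using h

lemma gaussDensity_eq_prod {n : ℕ} (z : Fin n → ℝ) :
    gaussDensity z = ∏ i, gaussianPDFReal 0 1 (z i) := by
  have h2 : (0 : ℝ) ≤ 2 * Real.pi := by positivity
  simp only [gaussDensity, gaussianPDFReal, Finset.prod_mul_distrib, ← Real.exp_sum]
  congr 1
  · simp only [NNReal.coe_one, mul_one, Finset.prod_const, Finset.card_univ, Fintype.card_fin]
    rw [Real.sqrt_eq_rpow, ← Real.rpow_neg h2, ← Real.rpow_natCast, ← Real.rpow_mul h2]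
    congr 1; ring
  · simp [← Finset.sum_div, Finset.sum_neg_distrib]

lemma integrable_gaussDensity {n : ℕ} : Integrable (gaussDensity (n := n)) := by
  simp_rw [funext (gaussDensity_eq_prod (n := n))]
  exact Integrable.fintype_prod (fun _ => integrable_gaussianPDFReal 0 1)

lemma integral_gaussDensity {n : ℕ} : ∫ z, gaussDensity (n := n) z = 1 := by
  simp_rw [gaussDensity_eq_prod]
  rw [integral_fintype_prod_volume_eq_prod]
  simp [integral_gaussianPDFReal_eq_one]

lemma integrable_gaussDensity_affine {n : ℕ} {R : Matrix (Fin n) (Fin n) ℝ} (hR : R.det ≠ 0)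
    (b : Fin n → ℝ) :
    Integrable (fun u => |R.det| * gaussDensity (R *ᵥ u - b)) ∧
      ∫ u, |R.det| * gaussDensity (R *ᵥ u - b) = 1 := by
  have hdet : LinearMap.det (Matrix.toLin' R) = R.det := LinearMap.det_toLin' R
  have hmap := Measure.map_linearMap_addHaar_eq_smul_addHaar
    (volume : Measure (Fin n → ℝ)) (f := Matrix.toLin' R) (by rwa [hdet])
  have hcont : Continuous (Matrix.toLin' R) := LinearMap.continuous_of_finiteDimensional _
  have hi : Integrable (fun y : Fin n → ℝ => gaussDensity (y - b)) :=
    integrable_gaussDensity.comp_sub_right b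
  have hc : Continuous (fun y : Fin n → ℝ => gaussDensity (y - b)) :=
    continuous_gaussDensity.comp (by fun_prop)
  constructor
  · have h1 : Integrable (fun y : Fin n → ℝ => gaussDensity (y - b))
        (Measure.map (Matrix.toLin' R) volume) := by
      rw [hmap]; exact hi.smul_measure (by simp)
    have h2 := (integrable_map_measure hc.aestronglyMeasurable hcont.aemeasurable).1 h1
    exact h2.const_mul _
  · have h1 : ∫ y, gaussDensity (y - b) ∂(Measure.map (Matrix.toLin' R) volume) =
        ∫ u, gaussDensity (R *ᵥ u - b) := by
      rw [integral_map hcont.aemeasurable hc.aestronglyMeasurable]; simp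
    rw [hmap, integral_smul_measure, 
      integral_sub_right_eq_self (μ := volume) (gaussDensity (n := n)) b,
      integral_gaussDensity, hdet] at h1
    rw [integral_const_mul, ← h1]
    simp [abs_inv, hR]

lemma hessian_apply {n : ℕ} {G : (Fin n → ℝ) → ℝ} (hG : ContDiff ℝ 2 G) (x : Fin n → ℝ)
    (i j : Fin n) :
    hessian G x i j = fderiv ℝ (fderiv ℝ G) x (Pi.single i 1) (Pi.single j 1) := by
  have hd : DifferentiableAt ℝ (fderiv ℝ G) x :=
    ((hG.fderiv_right (m := 1) (by norm_num)).differentiable (by norm_num)) x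
  simp only [hessian, pderiv', Matrix.of_apply]
  rw [fderiv_clm_apply hd (by fun_prop)]
  simp

lemma hessian_isSymm {n : ℕ} {G : (Fin n → ℝ) → ℝ} (hG : ContDiff ℝ 2 G) (x : Fin n → ℝ) :
    (hessian G x).IsSymm := by
  ext i j
  rw [Matrix.transpose_apply, hessian_apply hG, hessian_apply hG]
  exact (hG.contDiffAt.isSymmSndFDerivAt (by simp)) _ _

lemma deriv_deriv_comp_line {n : ℕ} {G : (Fin n → ℝ) → ℝ} (hG : ContDiff ℝ 2 G)
    (x v : Fin n → ℝ) :
    deriv (deriv fun t : ℝ => G (x + t • v)) 0 = v ⬝ᵥ (hessian G x *ᵥ v) := by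
  have hd : Differentiable ℝ (fderiv ℝ G) :=
    ((hG.fderiv_right (m := 1) (by norm_num)).differentiable (by norm_num))
  have hl : ∀ t : ℝ, HasDerivAt (fun t : ℝ => x + t • v) v t := fun t => by
    simpa using ((hasDerivAt_id t).smul_const v).const_add x
  have h1 : deriv (fun t : ℝ => G (x + t • v)) = fun t => fderiv ℝ G (x + t • v) v := by
    ext t
    exact ((hG.differentiable (by norm_num) _).hasFDerivAt.comp_hasDerivAt t (hl t)).deriv
  have h2 : HasDerivAt (fun t : ℝ => fderiv ℝ G (x + t • v) v)
      (fderiv ℝ (fderiv ℝ G) x v v) 0 := by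
    have h : HasFDerivAt (fun y => fderiv ℝ G y v)
        ((ContinuousLinearMap.apply ℝ ℝ v).comp (fderiv ℝ (fderiv ℝ G) x)) x :=
      (ContinuousLinearMap.apply ℝ ℝ v).hasFDerivAt.comp x (hd x).hasFDerivAt
    exact h.comp_hasDerivAt_of_eq 0 (hl 0) (by simp)
  rw [h1, h2.deriv]
  have hv : v = ∑ i, v i • (Pi.single i (1 : ℝ) : Fin n → ℝ) := by
    ext j; simp [Finset.sum_apply, Pi.single_apply]
  have h3 : fderiv ℝ (fderiv ℝ G) x v v = ∑ i, ∑ j, v i * (v j * hessian G x i j) := by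
    conv_lhs => rw [hv]
    simp only [map_sum, map_smul, _root_.sum_apply, _root_.smul_apply, smul_eq_mul, hessian_apply hG,
      Finset.mul_sum]
    rw [Finset.sum_comm]
    refine Finset.sum_congr rfl fun i _ => Finset.sum_congr rfl fun j _ => by ring
  rw [h3]
  simp only [dotProduct, mulVec, Finset.mul_sum]
  refine Finset.sum_congr rfl fun i _ => Finset.sum_congr rfl fun j _ => by ring

lemma deriv_deriv_mgf_mul_exp {Ω : Type*} [MeasurableSpace Ω] {ν : Measure Ω}
    [IsProbabilityMeasure ν] {X : Ω → ℝ} (hX : integrableExpSet X ν = Set.univ) (c : ℝ) :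
    deriv (deriv fun t => mgf X ν t * Real.exp (-(t ^ 2 * c) / 2)) 0 = ν[X ^ 2] - c := by
  have hmem : ∀ t, t ∈ interior (integrableExpSet X ν) := by simp [hX]
  have he : ∀ t : ℝ, HasDerivAt (fun t : ℝ => Real.exp (-(t ^ 2 * c) / 2))
      (Real.exp (-(t ^ 2 * c) / 2) * (-(t * c))) t := fun t => by
    have h := ((((hasDerivAt_id t).pow 2).mul_const c).neg.div_const 2).exp
    convert! h using 1
    simp; ring_nf
  have h1 : deriv (fun t => mgf X ν t * Real.exp (-(t ^ 2 * c) / 2)) =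
      fun t => deriv (mgf X ν) t * Real.exp (-(t ^ 2 * c) / 2) +
        mgf X ν t * (Real.exp (-(t ^ 2 * c) / 2) * (-(t * c))) := by
    ext t
    exact ((differentiableAt_mgf (hmem t)).hasDerivAt.mul (he t)).deriv
  have h2 : HasDerivAt (deriv (mgf X ν)) (ν[X ^ 2]) 0 := by
    have h := (differentiableAt_iteratedDeriv_mgf (hmem 0) 1).hasDerivAt
    rw [← iteratedDeriv_succ, iteratedDeriv_mgf_zero (hmem 0), iteratedDeriv_one] at h
    exact h
  rw [h1]
  refine ((h2.mul (he 0)).add ((differentiableAt_mgf (hmem 0)).hasDerivAt.mul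
    ((he 0).mul ((hasDerivAt_id (0 : ℝ)).mul_const c).neg))).deriv.trans ?_
  simp
  ring

lemma deriv_deriv_cgf_sub {Ω : Type*} [MeasurableSpace Ω] {ν : Measure Ω}
    [IsProbabilityMeasure ν] {X : Ω → ℝ} (hX : integrableExpSet X ν = Set.univ) (c : ℝ) :
    deriv (deriv fun t => cgf X ν t - t ^ 2 * c / 2) 0 = ν[fun ω => (X ω - ν[X]) ^ 2] - c := by
  have hmem : ∀ t, t ∈ interior (integrableExpSet X ν) := by simp [hX]
  have he : ∀ t : ℝ, HasDerivAt (fun t : ℝ => t ^ 2 * c / 2) (t * c) t := fun t => by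
    have h := ((((hasDerivAt_id t).pow 2).mul_const c).div_const 2)
    convert! h using 1
    simp; ring
  have h1 : deriv (fun t => cgf X ν t - t ^ 2 * c / 2) =
      fun t => deriv (cgf X ν) t - t * c := by
    ext t
    exact ((analyticAt_cgf (hmem t)).differentiableAt.hasDerivAt.sub (he t)).deriv
  have h2 := iteratedDeriv_two_cgf_eq_integral (hmem 0)
  rw [iteratedDeriv_succ, iteratedDeriv_one, deriv_cgf_zero (hmem 0)] at h2
  rw [h1]
  refine ((analyticAt_cgf (hmem 0)).deriv.differentiableAt.hasDerivAt.sub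
    ((hasDerivAt_id (0 : ℝ)).mul_const c)).deriv.trans ?_
  rw [h2]
  simp

open scoped MatrixOrder in
lemma exists_whitening {n : ℕ} {C : Matrix (Fin n) (Fin n) ℝ} (hC : C.PosDef) :
    ∃ R : Matrix (Fin n) (Fin n) ℝ, R.det ≠ 0 ∧ (∀ k, R k ⬝ᵥ (C *ᵥ R k) = 1) ∧
      Real.log |R.det| = -(1 / 2) * Real.log C.det := by
  obtain ⟨B, hB⟩ := CStarAlgebra.nonneg_iff_eq_star_mul_self.mp hC.posSemidef.nonneg
  rw [Matrix.star_eq_conjTranspose, Matrix.conjTranspose_eq_transpose_of_trivial] at hB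
  have hdet : C.det = B.det ^ 2 := by rw [hB, det_mul, det_transpose, sq]
  have hB0 : B.det ≠ 0 := fun h => by simpa [hdet, h] using hC.det_pos
  have hu : IsUnit B.det := hB0.isUnit
  have hRdet : (Bᵀ)⁻¹.det = (B.det)⁻¹ := by simp [det_nonsing_inv]
  refine ⟨(Bᵀ)⁻¹, by simp [hRdet, hB0], fun k => ?_, ?_⟩
  · have h : (Bᵀ)⁻¹ * C * ((Bᵀ)⁻¹)ᵀ = 1 := by
      rw [hB, ← Matrix.mul_assoc, nonsing_inv_mul _ (by simpa using hu), Matrix.one_mul,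
        transpose_nonsing_inv, transpose_transpose, mul_nonsing_inv _ hu]
    have hk := congrFun (congrFun h k) k
    rw [Matrix.one_apply_eq] at hk
    rw [← hk, Matrix.mul_assoc]
    rfl
  · rw [hRdet, hdet, Real.log_abs, Real.log_inv, Real.log_pow]
    push_cast; ring

/-- Among densities with given covariance, Gaussian ones minimise the entropy relative to `γₙ`
up to the second moment. -/
lemma entropy_stdGauss_ge {n : ℕ} {g : (Fin n → ℝ) → ℝ} (hpos : ∀ u, 0 < g u)
    (hg : Integrable g (stdGauss n)) (hg1 : ∫ u, g u ∂(stdGauss n) = 1)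
    (hlog : Integrable (fun u => g u * Real.log (g u)) (stdGauss n))
    (hsq : ∀ (v : Fin n → ℝ) (c : ℝ), Integrable (fun u => g u * (v ⬝ᵥ u - c) ^ 2) (stdGauss n))
    (m : (Fin n → ℝ) → ℝ) {C : Matrix (Fin n) (Fin n) ℝ} (hC : C.PosDef)
    (hvar : ∀ v, ∫ u, g u * (v ⬝ᵥ u - m v) ^ 2 ∂(stdGauss n) = v ⬝ᵥ (C *ᵥ v)) :
    (1 / 2) * ∑ i, (∫ u, g u * u i ^ 2 ∂(stdGauss n) - 1) - (1 / 2) * Real.log C.det ≤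
      ∫ u, g u * Real.log (g u) ∂(stdGauss n) := by
  obtain ⟨R, hR, hRC, hRlog⟩ := exists_whitening hC
  obtain ⟨hi, hi1⟩ := integrable_gaussDensity_affine hR (fun k => m (R k))
  set e : (Fin n → ℝ) → ℝ := fun u => Real.log |R.det|
    - (1 / 2) * ∑ k, (R k ⬝ᵥ u - m (R k)) ^ 2 + (1 / 2) * ∑ i, u i ^ 2 with he
  have hdens : ∀ u, |R.det| * gaussDensity (R *ᵥ u - fun k => m (R k)) =
      gaussDensity u * Real.exp (e u) := fun u => by
    have h0 : 0 < |R.det| := abs_pos.2 hR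
    simp only [he, gaussDensity, mulVec, Pi.sub_apply]
    rw [Real.exp_add, Real.exp_sub, Real.exp_log h0]
    rw [show -(∑ i, (R i ⬝ᵥ u - m (R i)) ^ 2) / 2 =
      -((1 / 2) * ∑ i, (R i ⬝ᵥ u - m (R i)) ^ 2) by ring,
      show -(∑ i, u i ^ 2) / 2 = -((1 / 2) * ∑ i, u i ^ 2) by ring, Real.exp_neg, Real.exp_neg]
    field_simp
  simp only [hdens] at hi hi1
  rw [← integrable_stdGauss_iff] at hi
  rw [← integral_stdGauss] at hi1
  have hcoord : ∀ i, Integrable (fun u => g u * u i ^ 2) (stdGauss n) := fun i => by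
    simpa using hsq (Pi.single i 1) 0
  have hge : ∀ u, g u * e u + g u - Real.exp (e u) ≤ g u * Real.log (g u) := fun u => by
    have h := Real.log_le_sub_one_of_pos (div_pos (Real.exp_pos (e u)) (hpos u))
    rw [Real.log_div (Real.exp_pos _).ne' (hpos u).ne', Real.log_exp] at h
    have h' := mul_le_mul_of_nonneg_left h (hpos u).le
    rw [mul_sub, mul_sub, mul_div_cancel₀ _ (hpos u).ne'] at h'
    linarith
  have hexp : (fun u => g u * e u) = fun u => Real.log |R.det| * g u
      - (1 / 2) * ∑ k, g u * (R k ⬝ᵥ u - m (R k)) ^ 2 + (1 / 2) * ∑ i, g u * u i ^ 2 := by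
    ext u
    simp only [he, ← Finset.mul_sum]
    ring
  have hA : Integrable (fun u => Real.log |R.det| * g u) (stdGauss n) := hg.const_mul _
  have hB : Integrable (fun u => (1 / 2) * ∑ k, g u * (R k ⬝ᵥ u - m (R k)) ^ 2) (stdGauss n) :=
    (integrable_finsetSum _ fun k _ => hsq (R k) (m (R k))).const_mul _
  have hD : Integrable (fun u => (1 / 2) * ∑ i, g u * u i ^ 2) (stdGauss n) :=
    (integrable_finsetSum _ fun i _ => hcoord i).const_mul _
  have hAB : Integrable (fun u => Real.log |R.det| * g u
      - (1 / 2) * ∑ k, g u * (R k ⬝ᵥ u - m (R k)) ^ 2) (stdGauss n) := hA.sub hB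
  have hge_int : Integrable (fun u => g u * e u) (stdGauss n) := by
    rw [hexp]; exact hAB.add hD
  have hval : ∫ u, g u * e u ∂(stdGauss n) =
      Real.log |R.det| - (1 / 2) * n + (1 / 2) * ∑ i, ∫ u, g u * u i ^ 2 ∂(stdGauss n) := by
    rw [hexp, integral_add hAB hD, integral_sub hA hB, integral_const_mul,
      integral_const_mul, integral_const_mul, integral_finsetSum _ fun k _ => hsq (R k) (m (R k)),
      integral_finsetSum _ fun i _ => hcoord i, hg1]
    simp [hvar, hRC]
  have hmono := integral_mono ((hge_int.add hg).sub hi) hlog hge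
  rw [integral_sub' (hge_int.add hg) hi, integral_add' hge_int hg, hval, hg1, hi1, hRlog] at hmono
  simp only [Finset.sum_sub_distrib, Finset.sum_const, Finset.card_univ, Fintype.card_fin]
  simp only [nsmul_eq_mul, mul_one]
  linarith

lemma gaussDensity_sub {n : ℕ} (u w : Fin n → ℝ) :
    gaussDensity (u - w) =
      Real.exp (-(w ⬝ᵥ w) / 2) * (gaussDensity u * Real.exp (w ⬝ᵥ u)) := by
  have h : -(∑ i, (u i - w i) ^ 2) / 2 = -(w ⬝ᵥ w) / 2 + -(∑ i, u i ^ 2) / 2 + w ⬝ᵥ u := by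
    simp only [dotProduct, neg_div, Finset.sum_div, ← Finset.sum_neg_distrib,
      ← Finset.sum_add_distrib]
    exact Finset.sum_congr rfl fun i _ => by ring
  simp only [gaussDensity, Pi.sub_apply]
  rw [h, Real.exp_add, Real.exp_add]
  ring

lemma integral_stdGauss_comp_add_left {n : ℕ} (g : (Fin n → ℝ) → ℝ) (w : Fin n → ℝ) :
    ∫ z, g (w + z) ∂(stdGauss n) =
      Real.exp (-(w ⬝ᵥ w) / 2) * ∫ u, g u * Real.exp (w ⬝ᵥ u) ∂(stdGauss n) := by
  rw [integral_stdGauss, integral_stdGauss, ← integral_const_mul,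
    ← integral_sub_right_eq_self (μ := volume) (fun z => gaussDensity z * g (w + z)) w]
  congr 1 with u
  rw [gaussDensity_sub, add_sub_cancel]
  ring

lemma integrable_mul_exp_dotProduct_stdGauss {n : ℕ} {g : (Fin n → ℝ) → ℝ} {w : Fin n → ℝ}
    (h : Integrable (fun z => g (w + z)) (stdGauss n)) :
    Integrable (fun u => g u * Real.exp (w ⬝ᵥ u)) (stdGauss n) := by
  rw [integrable_stdGauss_iff] at h ⊢
  refine ((h.comp_sub_right w).const_mul (Real.exp (-(w ⬝ᵥ w) / 2))⁻¹).congr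
    (Filter.Eventually.of_forall fun u => ?_)
  simp only [gaussDensity_sub, add_sub_cancel]
  field_simp

lemma integral_mul_sq_pos_stdGauss {n : ℕ} {g : (Fin n → ℝ) → ℝ} (hpos : ∀ u, 0 < g u)
    (hcont : Continuous g) {v : Fin n → ℝ} (hv : v ≠ 0) (c : ℝ)
    (hsq : Integrable (fun u => g u * (v ⬝ᵥ u - c) ^ 2) (stdGauss n)) :
    0 < ∫ u, g u * (v ⬝ᵥ u - c) ^ 2 ∂(stdGauss n) := by
  rw [integrable_stdGauss_iff] at hsq
  rw [integral_stdGauss]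
  have hnn : ∀ u : Fin n → ℝ, 0 ≤ gaussDensity u * (g u * (v ⬝ᵥ u - c) ^ 2) := fun u =>
    mul_nonneg (gaussDensity_pos u).le (mul_nonneg (hpos u).le (sq_nonneg _))
  refine (integral_nonneg hnn).lt_of_ne fun h0 => hv ?_
  have hae := (integral_eq_zero_iff_of_nonneg hnn hsq).1 h0.symm
  have hdot : Continuous fun u : Fin n → ℝ => v ⬝ᵥ u := by unfold dotProduct; fun_prop
  have heq := (Continuous.ae_eq_iff_eq volume
    (continuous_gaussDensity.mul (hcont.mul ((hdot.sub continuous_const).pow 2)))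
    continuous_zero).1 hae
  have hall : ∀ u, v ⬝ᵥ u = c := fun u => by
    have h := congrFun heq u
    simpa [(gaussDensity_pos u).ne', (hpos u).ne', sub_eq_zero] using h
  exact dotProduct_self_eq_zero.1 ((hall v).trans (by simpa using (hall 0).symm))

/-- **The reverse local intrinsic dimensional logarithmic Sobolev inequality on `ℝⁿ`**
(Theorem 9.8, eq. (9.41)): for a smooth positive `f` with `P_T f(x) = 1` and
`dμ/d(P_T δₓ) = f`,
`H(μ‖P_Tδₓ) ≥ (T/2)·ΔP_T f(x) − (1/2)·P_T f(x)·log det(Idₙ + T·∇²log P_T f(x))`. -/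
theorem stmt_15 {n : ℕ} (T : ℝ) (hT : 0 < T) (x : Fin n → ℝ)
    (f : (Fin n → ℝ) → ℝ) (hf : ContDiff ℝ (⊤ : ℕ∞) f) (hfpos : ∀ y, 0 < f y)
    (hnorm : heatSG T f x = 1)
    -- suitable regularity and integrability so that all appearing quantities are finite
    (hreg : ContDiff ℝ (⊤ : ℕ∞) (heatSG T f : (Fin n → ℝ) → ℝ))
    (hint0 : ∀ y : Fin n → ℝ, Integrable (fun z => f (y + Real.sqrt T • z)) (stdGauss n))
    (hint1 : Integrable (fun z : Fin n → ℝ =>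
      f (x + Real.sqrt T • z) * Real.log (f (x + Real.sqrt T • z))) (stdGauss n)) :
    heatSG T (fun y => f y * Real.log (f y)) x - heatSG T f x * Real.log (heatSG T f x) ≥
      (T / 2) * (∑ i : Fin n, pderiv' (fun y => pderiv' (heatSG T f) i y) i x) -
      (1 / 2 : ℝ) * heatSG T f x * Real.log (Matrix.det
        ((1 : Matrix (Fin n) (Fin n) ℝ) +
          T • hessian (fun y => Real.log (heatSG T f y)) x)) := by
  set s := Real.sqrt T with hs
  have hss : s * s = T := Real.mul_self_sqrt hT.le
  have hs0 : s ≠ 0 := (Real.sqrt_pos.2 hT).ne'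
  set g : (Fin n → ℝ) → ℝ := fun u => f (x + s • u) with hg
  have hgpos : ∀ u, 0 < g u := fun u => hfpos _
  have hgcont : Continuous g := hf.continuous.comp (by fun_prop)
  have hgint : Integrable g (stdGauss n) := hint0 x
  have hg1 : ∫ u, g u ∂(stdGauss n) = 1 := hnorm
  set ν : Measure (Fin n → ℝ) := (stdGauss n).withDensity fun u => ENNReal.ofReal (g u) with hν
  have hνint : ∀ k : (Fin n → ℝ) → ℝ, Integrable k ν ↔
      Integrable (fun u => g u * k u) (stdGauss n) := fun k => by
    have h := integrable_withDensity_iff_integrable_smul' (μ := stdGauss n) (g := k)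
      (hgcont.measurable.ennreal_ofReal) (by simp)
    simpa [ENNReal.toReal_ofReal (hgpos _).le] using h
  have hνval : ∀ k : (Fin n → ℝ) → ℝ, ∫ u, k u ∂ν = ∫ u, g u * k u ∂(stdGauss n) := fun k => by
    have h := integral_withDensity_eq_integral_toReal_smul (μ := stdGauss n)
      (hgcont.measurable.ennreal_ofReal) (by simp) k
    simpa [ENNReal.toReal_ofReal (hgpos _).le] using h
  have hprob : IsProbabilityMeasure ν := ⟨by
    rw [hν, withDensity_apply _ MeasurableSet.univ, Measure.restrict_univ,
      ← ofReal_integral_eq_lintegral_ofReal hgint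
        (Filter.Eventually.of_forall fun u => (hgpos u).le), hg1, ENNReal.ofReal_one]⟩
  have hset : ∀ v : Fin n → ℝ, integrableExpSet (fun u => v ⬝ᵥ u) ν = Set.univ := fun v => by
    refine Set.eq_univ_of_forall fun t => (hνint _).2 ?_
    have h : Integrable (fun z => g (t • v + z)) (stdGauss n) := by
      have h := hint0 (x + s • t • v)
      simpa only [hg, smul_add, add_assoc] using h
    simpa only [smul_dotProduct, smul_eq_mul] using integrable_mul_exp_dotProduct_stdGauss h
  have hline : ∀ (v : Fin n → ℝ) (t : ℝ), heatSG T f (x + t • s • v) =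
      mgf (fun u => v ⬝ᵥ u) ν t * Real.exp (-(t ^ 2 * (v ⬝ᵥ v)) / 2) := fun v t => by
    have h := integral_stdGauss_comp_add_left g (t • v)
    simp only [smul_dotProduct, dotProduct_smul, smul_eq_mul] at h
    rw [mgf, hνval, mul_comm, show t ^ 2 * (v ⬝ᵥ v) = t * (t * (v ⬝ᵥ v)) by ring, ← h]
    simp only [heatSG, hg, smul_add, add_assoc, smul_comm t s v]
    rfl
  have hmgf : ∀ (v : Fin n → ℝ) (t : ℝ), 0 < mgf (fun u => v ⬝ᵥ u) ν t := fun v t =>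
    mgf_pos (by have h : t ∈ integrableExpSet (fun u => v ⬝ᵥ u) ν := by simp [hset]
                exact h)
  have hGpos : ∀ y, 0 < heatSG T f y := fun y => by
    have h := hline (s⁻¹ • (y - x)) 1
    rw [smul_smul s, mul_inv_cancel₀ hs0, one_smul, one_smul, add_sub_cancel] at h
    rw [h]
    exact mul_pos (hmgf _ _) (Real.exp_pos _)
  have hG2 : ContDiff ℝ 2 (heatSG T f : (Fin n → ℝ) → ℝ) := contDiff_infty.1 hreg 2
  have hL2 : ContDiff ℝ 2 (fun y => Real.log (heatSG T f y)) := hG2.log fun y => (hGpos y).ne'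
  have hquad : ∀ (M : Matrix (Fin n) (Fin n) ℝ) (v : Fin n → ℝ),
      (s • v) ⬝ᵥ (M *ᵥ (s • v)) = T * (v ⬝ᵥ (M *ᵥ v)) := fun M v => by
    simp only [mulVec_smul, smul_dotProduct, dotProduct_smul, smul_eq_mul, ← hss, mul_assoc]
  have hlap : ∀ v : Fin n → ℝ, T * (v ⬝ᵥ (hessian (heatSG T f) x *ᵥ v)) =
      ∫ u, g u * (v ⬝ᵥ u) ^ 2 ∂(stdGauss n) - v ⬝ᵥ v := fun v => by
    rw [← hquad, ← deriv_deriv_comp_line hG2, funext (hline v), deriv_deriv_mgf_mul_exp (hset v),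
      hνval]
    rfl
  set m : (Fin n → ℝ) → ℝ := fun v => ∫ u, v ⬝ᵥ u ∂ν with hm
  have hhess : ∀ v : Fin n → ℝ,
      T * (v ⬝ᵥ (hessian (fun y => Real.log (heatSG T f y)) x *ᵥ v)) =
      ∫ u, g u * (v ⬝ᵥ u - m v) ^ 2 ∂(stdGauss n) - v ⬝ᵥ v := fun v => by
    have hfun : (fun t : ℝ => Real.log (heatSG T f (x + t • s • v))) =
        fun t => cgf (fun u => v ⬝ᵥ u) ν t - t ^ 2 * (v ⬝ᵥ v) / 2 := by
      ext t
      rw [hline, Real.log_mul (hmgf v t).ne' (Real.exp_pos _).ne', Real.log_exp, cgf]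
      ring
    rw [← hquad, ← deriv_deriv_comp_line hL2, hfun, deriv_deriv_cgf_sub (hset v), hνval]
  set C := (1 : Matrix (Fin n) (Fin n) ℝ) +
    T • hessian (fun y => Real.log (heatSG T f y)) x with hCdef
  have hvar : ∀ v, ∫ u, g u * (v ⬝ᵥ u - m v) ^ 2 ∂(stdGauss n) = v ⬝ᵥ (C *ᵥ v) := fun v => by
    simp only [hCdef, add_mulVec, one_mulVec, dotProduct_add, smul_mulVec, dotProduct_smul,
      smul_eq_mul, hhess]
    ring
  have hsq : ∀ (v : Fin n → ℝ) (c : ℝ),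
      Integrable (fun u => g u * (v ⬝ᵥ u - c) ^ 2) (stdGauss n) := fun v c => by
    have h : MemLp (fun u => v ⬝ᵥ u) 2 ν :=
      memLp_of_mem_interior_integrableExpSet (by simp [hset]) 2
    exact (hνint _).1 (h.sub (memLp_const c)).integrable_sq
  have hCsymm : C.IsHermitian := by
    rw [Matrix.IsHermitian, conjTranspose_eq_transpose_of_trivial, hCdef, transpose_add,
      transpose_one, transpose_smul, hessian_isSymm hL2 x]
  have hC : C.PosDef := PosDef.of_dotProduct_mulVec_pos hCsymm fun v hv => by
    rw [star_trivial, ← hvar]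
    exact integral_mul_sq_pos_stdGauss hgpos hgcont hv _ (hsq v _)
  have hmain := entropy_stdGauss_ge hgpos hgint hg1 hint1 hsq m hC hvar
  have htrace : T * ∑ i : Fin n, pderiv' (fun y => pderiv' (heatSG T f) i y) i x =
      ∑ i, (∫ u, g u * u i ^ 2 ∂(stdGauss n) - 1) := by
    rw [Finset.mul_sum]
    refine Finset.sum_congr rfl fun i _ => ?_
    simpa [hessian] using hlap (Pi.single i 1)
  rw [hnorm, Real.log_one, mul_zero, sub_zero, mul_one, ge_iff_le, div_mul_eq_mul_div, htrace]
  refine le_trans (le_of_eq ?_) hmain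
  ring
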